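/- Assume f₁ = f₂, and write F̲(w) = f₁(‖w₁‖²,‖w₂‖²) for w ∈ 𝓗². Let u₀ ∈ 𝓗², let u be the solution of the nonlinear Landau–Zener system with datum u₀ and let u^lin be the solution of the linear system (δ = 0) with the same datum u₀. Then for all s ∈ ℝ: F̲(u(s)) = F̲(u^lin(s)) and u(s) = e^{iδ∫₀ˢ F̲(u^lin(τ))dτ}·u^lin(s). -/

import Mathlib

open ContinuousLinearMap Complex Filter Topology
open scoped InnerProductSpace

noncomputable section

variable {H : Type*} [NormedAddCommGroup H] [InnerProductSpace ℂ H] [CompleteSpace H]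

/-- Functional calculus `χ(A)` of a selfadjoint operator `A` for a complex-valued
function `χ : ℝ → ℂ` (defined via the real continuous functional calculus applied to
the real and imaginary parts of `χ`). -/
def fc (χ : ℝ → ℂ) (A : H →L[ℂ] H) : H →L[ℂ] H :=
  cfc (fun x : ℝ => (χ x).re) A + Complex.I • cfc (fun x : ℝ => (χ x).im) A

/-- The commutation assumption: for every continuous `χ : ℝ → ℂ`,
`χ(GG*)G = Gχ(G*G)` and `χ(G*G)G* = G*χ(GG*)`. -/
def CommHyp (G : H →L[ℂ] H) : Prop :=
  ∀ χ : ℝ → ℂ, Continuous χ →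
    (fc χ (G * ContinuousLinearMap.adjoint G)) ∘L G
        = G ∘L (fc χ (ContinuousLinearMap.adjoint G * G)) ∧
    (fc χ (ContinuousLinearMap.adjoint G * G)) ∘L ContinuousLinearMap.adjoint G
        = ContinuousLinearMap.adjoint G ∘L (fc χ (G * ContinuousLinearMap.adjoint G))

/-- The equivalence between `𝓗²` (with its Hilbert space structure) and `𝓗 × 𝓗`. -/
def eqv : WithLp 2 (H × H) ≃L[ℂ] H × H := WithLp.prodContinuousLinearEquiv 2 ℂ H H

/-- The operator `V(s)(w₁,w₂) = (s·w₁ + Gw₂, G*w₁ − s·w₂)` on `𝓗²`. -/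
def Vop (G : H →L[ℂ] H) (s : ℝ) : WithLp 2 (H × H) →L[ℂ] WithLp 2 (H × H) :=
  (eqv (H := H)).symm.toContinuousLinearMap ∘L
    ((((s : ℂ) • ContinuousLinearMap.fst ℂ H H + G ∘L ContinuousLinearMap.snd ℂ H H)).prod
      ((ContinuousLinearMap.adjoint G) ∘L ContinuousLinearMap.fst ℂ H H
        - (s : ℂ) • ContinuousLinearMap.snd ℂ H H)) ∘L
    (eqv (H := H)).toContinuousLinearMap

/-- `F₁(u) = f₁(‖u₁‖², ‖u₂‖²)`. -/
def F1 (f₁ : ℝ × ℝ → ℝ) (u : WithLp 2 (H × H)) : ℝ := f₁ (‖u.fst‖ ^ 2, ‖u.snd‖ ^ 2)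

/-- `F₂(u) = f₂(‖u₁‖², ‖u₂‖²)`. -/
def F2 (f₂ : ℝ × ℝ → ℝ) (u : WithLp 2 (H × H)) : ℝ := f₂ (‖u.fst‖ ^ 2, ‖u.snd‖ ^ 2)

/-- The nonlinear term `F(u)u = (F₁(u)u₁, F₂(u)u₂)`. -/
def nlt (f₁ f₂ : ℝ × ℝ → ℝ) (u : WithLp 2 (H × H)) : WithLp 2 (H × H) :=
  (WithLp.equiv 2 (H × H)).symm ((F1 f₁ u) • u.fst, (F2 f₂ u) • u.snd)

/-- `u` is a (global, `C¹`) solution of `−i u′(s) = V(s)u(s) + δ F(u(s))u(s)`: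
equivalently, `u′(s) = i (V(s)u(s) + δ F(u(s))u(s))` for all `s`. -/
def IsLZSol (G : H →L[ℂ] H) (δ : ℝ) (f₁ f₂ : ℝ × ℝ → ℝ) (u : ℝ → WithLp 2 (H × H)) : Prop :=
  ∀ s : ℝ, HasDerivAt u (Complex.I • (Vop G s (u s) + δ • nlt f₁ f₂ (u s))) s

/-- `f ∈ C²(ℝ²;ℝ)` with bounded second derivative. -/
def C2Bdd (f : ℝ × ℝ → ℝ) : Prop :=
  ContDiff ℝ 2 f ∧ ∃ C : ℝ, ∀ p : ℝ × ℝ, ‖iteratedFDeriv ℝ 2 f p‖ ≤ C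

/-- `θ ∈ C_c^∞(ℝ;ℝ)`, `0 ≤ θ ≤ 1`, `θ = 1` on `(−1/2,1/2)` and `θ = 0` outside `[−1,1]`. -/
def IsCutoff (θ : ℝ → ℝ) : Prop :=
  ContDiff ℝ (⊤ : ℕ∞) θ ∧ HasCompactSupport θ ∧ (∀ x, 0 ≤ θ x ∧ θ x ≤ 1) ∧
    (∀ x, |x| < 1/2 → θ x = 1) ∧ (∀ x, 1 < |x| → θ x = 0)

/-- The cutoff operator `Θ_R = diag(θ(GG*/R²), θ(G*G/R²))`. -/
def Theta (G : H →L[ℂ] H) (θ : ℝ → ℝ) (R : ℝ) :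
    WithLp 2 (H × H) →L[ℂ] WithLp 2 (H × H) :=
  (eqv (H := H)).symm.toContinuousLinearMap ∘L
    ((cfc (fun x : ℝ => θ (x / R ^ 2)) (G * ContinuousLinearMap.adjoint G)).prodMap
      (cfc (fun x : ℝ => θ (x / R ^ 2)) (ContinuousLinearMap.adjoint G * G))) ∘L
    (eqv (H := H)).toContinuousLinearMap

/-- The phase `φ(s,λ) = s²/2 + (λ/2)·log|s|`. -/
def phase (s lam : ℝ) : ℝ := s ^ 2 / 2 + lam / 2 * Real.log |s|

/-- The unitary operator `e^{iφ(s,GG*)}` on `𝓗`. -/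
def ePhaseP (G : H →L[ℂ] H) (s : ℝ) : H →L[ℂ] H :=
  fc (fun lam => Complex.exp (Complex.I * (phase s lam))) (G * ContinuousLinearMap.adjoint G)

/-- The unitary operator `e^{−iφ(s,G*G)}` on `𝓗`. -/
def ePhaseM (G : H →L[ℂ] H) (s : ℝ) : H →L[ℂ] H :=
  fc (fun lam => Complex.exp (-(Complex.I * (phase s lam))))
    (ContinuousLinearMap.adjoint G * G)

/-- The model asymptotic first component `e^{iδF₁(ω)s + iϕ}·e^{iφ(s,GG*)}ω₁`. -/
def asym1 (G : H →L[ℂ] H) (δ : ℝ) (f₁ : ℝ × ℝ → ℝ) (ω : WithLp 2 (H × H)) (ϕ : ℝ)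
    (s : ℝ) : H :=
  Complex.exp (Complex.I * (δ * F1 f₁ ω * s + ϕ)) • (ePhaseP G s ω.fst)

/-- The model asymptotic second component `e^{iδF₂(ω)s − iϕ}·e^{−iφ(s,G*G)}ω₂`. -/
def asym2 (G : H →L[ℂ] H) (δ : ℝ) (f₂ : ℝ × ℝ → ℝ) (ω : WithLp 2 (H × H)) (ϕ : ℝ)
    (s : ℝ) : H :=
  Complex.exp (Complex.I * (δ * F2 f₂ ω * s - ϕ)) • (ePhaseM G s ω.snd)

/-- `α` is the incoming scattering state (at `s → −∞`) of `u`, with phase shift `ϕ`. -/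
def Incoming (G : H →L[ℂ] H) (δ : ℝ) (f₁ f₂ : ℝ × ℝ → ℝ) (α : WithLp 2 (H × H)) (ϕ : ℝ)
    (u : ℝ → WithLp 2 (H × H)) : Prop :=
  Tendsto (fun s => ‖(u s).fst - asym1 G δ f₁ α ϕ s‖ + ‖(u s).snd - asym2 G δ f₂ α ϕ s‖)
    atBot (𝓝 0)

/-- `ω` is the outgoing scattering state (at `s → +∞`) of `u`, with phase shift `ϕ`. -/
def Outgoing (G : H →L[ℂ] H) (δ : ℝ) (f₁ f₂ : ℝ × ℝ → ℝ) (ω : WithLp 2 (H × H)) (ϕ : ℝ)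
    (u : ℝ → WithLp 2 (H × H)) : Prop :=
  Tendsto (fun s => ‖(u s).fst - asym1 G δ f₁ ω ϕ s‖ + ‖(u s).snd - asym2 G δ f₂ ω ϕ s‖)
    atTop (𝓝 0)

/-- `M(u) = (δ/2)(F₁(u) + F₂(u))`. -/
def Mscal (δ : ℝ) (f₁ f₂ : ℝ × ℝ → ℝ) (u : WithLp 2 (H × H)) : ℝ :=
  δ / 2 * (F1 f₁ u + F2 f₂ u)

/-- `m(u) = (δ/2)(F₁(u) − F₂(u))`. -/
def mscal (δ : ℝ) (f₁ f₂ : ℝ × ℝ → ℝ) (u : WithLp 2 (H × H)) : ℝ :=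
  δ / 2 * (F1 f₁ u - F2 f₂ u)

/-- The gauge transform `v(s) = e^{−i∫₀ˢ M(u(τ))dτ}·u(s)`. -/
def gaugeT (δ : ℝ) (f₁ f₂ : ℝ × ℝ → ℝ) (u : ℝ → WithLp 2 (H × H)) :
    ℝ → WithLp 2 (H × H) :=
  fun s => Complex.exp (-(Complex.I * (∫ τ in (0:ℝ)..s, Mscal δ f₁ f₂ (u τ)))) • u s

/-- `σ(s) = s + m(u(s))`. -/
def sigma (δ : ℝ) (f₁ f₂ : ℝ × ℝ → ℝ) (u : ℝ → WithLp 2 (H × H)) (s : ℝ) : ℝ :=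
  s + mscal δ f₁ f₂ (u s)

/-- The operator `Λ_t = diag((t² + GG*)^{1/2}, (t² + G*G)^{1/2})` on `𝓗²`. -/
def LamOp (G : H →L[ℂ] H) (t : ℝ) : WithLp 2 (H × H) →L[ℂ] WithLp 2 (H × H) :=
  (eqv (H := H)).symm.toContinuousLinearMap ∘L
    ((cfc (fun x : ℝ => Real.sqrt (t ^ 2 + x)) (G * ContinuousLinearMap.adjoint G)).prodMap
      (cfc (fun x : ℝ => Real.sqrt (t ^ 2 + x)) (ContinuousLinearMap.adjoint G * G))) ∘L
    (eqv (H := H)).toContinuousLinearMap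

/-- The operator `Λ_t⁻¹ = diag((t² + GG*)^{-1/2}, (t² + G*G)^{-1/2})` on `𝓗²`. -/
def LamInv (G : H →L[ℂ] H) (t : ℝ) : WithLp 2 (H × H) →L[ℂ] WithLp 2 (H × H) :=
  (eqv (H := H)).symm.toContinuousLinearMap ∘L
    ((cfc (fun x : ℝ => (Real.sqrt (t ^ 2 + x))⁻¹)
        (G * ContinuousLinearMap.adjoint G)).prodMap
      (cfc (fun x : ℝ => (Real.sqrt (t ^ 2 + x))⁻¹)
        (ContinuousLinearMap.adjoint G * G))) ∘L
    (eqv (H := H)).toContinuousLinearMap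

/-- The projection `Π_t^+ = (1/2)(Id + Λ_t⁻¹V(t))`. -/
def PiP (G : H →L[ℂ] H) (t : ℝ) : WithLp 2 (H × H) →L[ℂ] WithLp 2 (H × H) :=
  (2 : ℂ)⁻¹ • (1 + LamInv G t ∘L Vop G t)

/-- The projection `Π_t^- = (1/2)(Id − Λ_t⁻¹V(t))`. -/
def PiM (G : H →L[ℂ] H) (t : ℝ) : WithLp 2 (H × H) →L[ℂ] WithLp 2 (H × H) :=
  (2 : ℂ)⁻¹ • (1 - LamInv G t ∘L Vop G t)

/-- `m̃(x,y) = (δ/2)(f₁(x,y) − f₂(x,y))`. -/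
def mtilde (δ : ℝ) (f₁ f₂ : ℝ × ℝ → ℝ) : ℝ × ℝ → ℝ := fun p => δ / 2 * (f₁ p - f₂ p)

/-- `m̲(s) = (∂₁m̃ − ∂₂m̃)(‖v₁(s)‖², ‖v₂(s)‖²)`. -/
def mbar (δ : ℝ) (f₁ f₂ : ℝ × ℝ → ℝ) (v : ℝ → WithLp 2 (H × H)) (s : ℝ) : ℝ :=
  fderiv ℝ (mtilde δ f₁ f₂) (‖(v s).fst‖ ^ 2, ‖(v s).snd‖ ^ 2) (1, 0) -
    fderiv ℝ (mtilde δ f₁ f₂) (‖(v s).fst‖ ^ 2, ‖(v s).snd‖ ^ 2) (0, 1)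


/-- The operator `A(a,b,c,d)(w₁,w₂) = (a(GG*)w₁ + b(GG*)Gw₂, c(G*G)G*w₁ + d(G*G)w₂)`. -/
def Aop (G : H →L[ℂ] H) (a b c d : ℝ → ℂ) :
    WithLp 2 (H × H) →L[ℂ] WithLp 2 (H × H) :=
  (eqv (H := H)).symm.toContinuousLinearMap ∘L
    (((fc a (G * ContinuousLinearMap.adjoint G)) ∘L ContinuousLinearMap.fst ℂ H H
        + (fc b (G * ContinuousLinearMap.adjoint G)) ∘L G ∘L ContinuousLinearMap.snd ℂ H H).prod
      ((fc c (ContinuousLinearMap.adjoint G * G)) ∘L (ContinuousLinearMap.adjoint G)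
          ∘L ContinuousLinearMap.fst ℂ H H
        + (fc d (ContinuousLinearMap.adjoint G * G)) ∘L ContinuousLinearMap.snd ℂ H H)) ∘L
    (eqv (H := H)).toContinuousLinearMap

/-- The operator `𝒦(w₁,w₂) = (−Gw₂, G*w₁)` on `𝓗²`. -/
def Kcal (G : H →L[ℂ] H) : WithLp 2 (H × H) →L[ℂ] WithLp 2 (H × H) :=
  (eqv (H := H)).symm.toContinuousLinearMap ∘L
    ((-(G ∘L ContinuousLinearMap.snd ℂ H H)).prod
      ((ContinuousLinearMap.adjoint G) ∘L ContinuousLinearMap.fst ℂ H H)) ∘L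
    (eqv (H := H)).toContinuousLinearMap


theorem Vop_apply_fst (G : H →L[ℂ] H) (s : ℝ) (w : WithLp 2 (H × H)) :
    (Vop G s w).fst = (s : ℂ) • w.fst + G w.snd := rfl

theorem Vop_apply_snd (G : H →L[ℂ] H) (s : ℝ) (w : WithLp 2 (H × H)) :
    (Vop G s w).snd = ContinuousLinearMap.adjoint G w.fst - (s : ℂ) • w.snd := rfl

theorem inner_Vop_left (G : H →L[ℂ] H) (s : ℝ) (w z : WithLp 2 (H × H)) :
    inner ℂ (Vop G s w) z = inner ℂ w (Vop G s z) := by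
  simp only [WithLp.prod_inner_apply, WithLp.ofLp_fst, WithLp.ofLp_snd, Vop_apply_fst,
    Vop_apply_snd, inner_add_left, inner_add_right, inner_sub_left, inner_sub_right,
    inner_smul_left, inner_smul_right, ContinuousLinearMap.adjoint_inner_left,
    ContinuousLinearMap.adjoint_inner_right, Complex.conj_ofReal]
  ring

theorem nlt_self {E : Type*} [NormedAddCommGroup E] [InnerProductSpace ℂ E]
    (f : ℝ × ℝ → ℝ) (w : WithLp 2 (E × E)) : nlt f f w = F1 f w • w := rfl

theorem F1_smul_of_norm_eq_one {E : Type*} [NormedAddCommGroup E] [InnerProductSpace ℂ E]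
    (f : ℝ × ℝ → ℝ) {c : ℂ} (hc : ‖c‖ = 1) (w : WithLp 2 (E × E)) :
    F1 f (c • w) = F1 f w := by
  simp [F1, norm_smul, hc]

/-- The linear Landau–Zener flow is unitary, so a solution with zero datum vanishes. -/
theorem eq_zero_of_hasDerivAt_Vop (G : H →L[ℂ] H) {w : ℝ → WithLp 2 (H × H)}
    (hw : ∀ s, HasDerivAt w (Complex.I • Vop G s (w s)) s) (h0 : w 0 = 0) (s : ℝ) : w s = 0 := by
  have hd : ∀ t, HasDerivAt (fun r => inner ℂ (w r) (w r)) 0 t := fun t => by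
    refine ((hw t).inner ℂ (hw t)).congr_deriv ?_
    rw [inner_smul_left, inner_smul_right, inner_Vop_left, Complex.conj_I]
    ring
  have hconst := is_const_of_deriv_eq_zero (fun t => (hd t).differentiableAt)
    (fun t => (hd t).deriv) s 0
  simpa [h0] using hconst

/-- when `f₁ = f₂`, the nonlinear solution is an explicit gauge
transform of the linear one (identity (6.1)). -/
theorem stmt_19 (G : H →L[ℂ] H) (δ : ℝ) (f₁ f₂ : ℝ × ℝ → ℝ)
    (hf₁ : C2Bdd f₁) (hf₂ : C2Bdd f₂) (hf : f₁ = f₂) (u₀ : WithLp 2 (H × H))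
    (u : ℝ → WithLp 2 (H × H)) (hu : IsLZSol G δ f₁ f₂ u) (hu0 : u 0 = u₀)
    (ulin : ℝ → WithLp 2 (H × H)) (hulin : IsLZSol G 0 f₁ f₂ ulin)
    (hulin0 : ulin 0 = u₀) :
    ∀ s : ℝ, F1 f₁ (u s) = F1 f₁ (ulin s) ∧
      u s = Complex.exp (Complex.I * (δ * ∫ τ in (0:ℝ)..s, F1 f₁ (ulin τ))) • ulin s := by
  subst hf
  have hF : Continuous fun τ => F1 f₁ (u τ) := by
    have hc : Continuous u := continuous_iff_continuousAt.2 fun s => (hu s).continuousAt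
    have h1 : Continuous fun τ => (u τ).fst := (WithLp.prod_continuous_ofLp 2 H H).fst.comp hc
    have h2 : Continuous fun τ => (u τ).snd := (WithLp.prod_continuous_ofLp 2 H H).snd.comp hc
    exact hf₁.1.continuous.comp ((h1.norm.pow 2).prodMk (h2.norm.pow 2))
  set Φ : ℝ → ℝ := fun s => δ * ∫ τ in (0:ℝ)..s, F1 f₁ (u τ) with hΦ
  have hΦd : ∀ s, HasDerivAt Φ (δ * F1 f₁ (u s)) s := fun s =>
    (intervalIntegral.integral_hasDerivAt_right (hF.intervalIntegrable _ _)
      (hF.stronglyMeasurableAtFilter _ _) hF.continuousAt).const_mul δ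
  have hed : ∀ s, HasDerivAt (fun s => Complex.exp (-(Complex.I * Φ s)))
      (Complex.exp (-(Complex.I * Φ s)) * -(Complex.I * (δ * F1 f₁ (u s) : ℝ))) s := fun s =>
    (((hΦd s).ofReal_comp.const_mul Complex.I).neg).cexp
  have hgauge : ∀ s, Complex.exp (-(Complex.I * Φ s)) • u s = ulin s := fun s => by
    refine sub_eq_zero.1 (eq_zero_of_hasDerivAt_Vop G
      (w := fun s => Complex.exp (-(Complex.I * Φ s)) • u s - ulin s) (fun t => ?_) ?_ s)
    · refine (((hed t).smul (hu t)).sub (hulin t)).congr_deriv ?_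
      simp only [nlt_self, ← Complex.coe_smul (F1 _ _), ← Complex.coe_smul δ, map_sub, map_smul]
      push_cast
      module
    · simp [hΦ, hu0, hulin0]
  have hnorm : ∀ x : ℝ, ‖Complex.exp (-(Complex.I * x))‖ = 1 := fun x => by
    simp [Complex.norm_exp]
  have hFeq : ∀ s, F1 f₁ (u s) = F1 f₁ (ulin s) := fun s => by
    rw [← hgauge s, F1_smul_of_norm_eq_one f₁ (hnorm _)]
  refine fun s => ⟨hFeq s, ?_⟩
  have hphase : (δ * ((∫ τ in (0:ℝ)..s, F1 f₁ (ulin τ) : ℝ) : ℂ)) = Φ s := by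
    simp [hΦ, hFeq]
  rw [hphase, ← hgauge s, smul_smul, ← Complex.exp_add, add_neg_cancel, Complex.exp_zero, one_smul]

end
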